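/- Let B be a standard Brownian motion, a > 0, and t > 0. If h: ℝ → ℝ is a Borel function with E|h(B_a)| < ∞ and E[h(B_a) | B_{t+a}] = 0 almost surely, then h(B_a) = 0 almost surely. Consequently the bridge operator Λ_t f = E[f(B_a)|B_{t+a}=·] for the Gauss–Gauss process has trivial kernel: Ker Λ_t = {0} in L¹(γ) where γ = N(0,a). -/

import Mathlib

open MeasureTheory

theorem conv_formula {Ω : Type*} [MeasurableSpace Ω] (P : Measure Ω) [IsProbabilityMeasure P]
    (Z W : Ω → ℝ) (hZ : Measurable Z) (hW : Measurable W)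
    (hindep : ProbabilityTheory.IndepFun Z W P)
    (f : ℝ → ENNReal) (hf : Measurable f) (s : Set ℝ) (hs : MeasurableSet s) :
    (Measure.conv ((P.map Z).withDensity f) (P.map W)) s
      = ∫⁻ ω in (fun ω => Z ω + W ω) ⁻¹' s, f (Z ω) ∂P := by
  have : IsProbabilityMeasure (P.map Z) := Measure.isProbabilityMeasure_map hZ.aemeasurable
  have : IsProbabilityMeasure (P.map W) := Measure.isProbabilityMeasure_map hW.aemeasurable
  have h1 := (ProbabilityTheory.indepFun_iff_map_prod_eq_prod_map_map
    hZ.aemeasurable hW.aemeasurable).1 hindep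
  have hs' : MeasurableSet ((fun x : ℝ × ℝ => x.1 + x.2) ⁻¹' s) :=
    (measurable_fst.add measurable_snd) hs
  unfold Measure.conv
  rw [prod_withDensity_left hf, ← h1, Measure.map_apply (by fun_prop) hs,
    withDensity_apply _ hs', setLIntegral_map hs' (by fun_prop) (by fun_prop)]
  rfl

/-- For the Gauss–Gauss process: if `B_a ~ N(0,a)` and the increment `W = B_{t+a} - B_a ~ N(0,t)`
is independent of `B_a`, and `h` is Borel with `E|h(B_a)| < ∞` and
`E[h(B_a) | B_{t+a}] = 0` a.s., then `h(B_a) = 0` a.s.; i.e. the bridge operator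
`Λ_t f = E[f(B_a)|B_{t+a}=·]` has trivial kernel. -/
theorem stmt_8 {Ω : Type*} [MeasurableSpace Ω] (P : Measure Ω) [IsProbabilityMeasure P]
    (a t : ℝ) (ha : 0 < a) (ht : 0 < t)
    (Z W : Ω → ℝ) (hZ : Measurable Z) (hW : Measurable W)
    (hZlaw : P.map Z = ProbabilityTheory.gaussianReal 0 a.toNNReal)
    (hWlaw : P.map W = ProbabilityTheory.gaussianReal 0 t.toNNReal)
    (hindep : ProbabilityTheory.IndepFun Z W P)
    (h : ℝ → ℝ) (hh : Measurable h)
    (hint : Integrable (fun ω => h (Z ω)) P)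
    (hcond : P[(fun ω => h (Z ω))|MeasurableSpace.comap (fun ω => Z ω + W ω) (by infer_instance)]
        =ᵐ[P] 0) :
    (fun ω => h (Z ω)) =ᵐ[P] 0 := by
  have hS : Measurable (fun ω => Z ω + W ω) := hZ.add hW
  have hset : ∀ s : Set ℝ, MeasurableSet s →
      ∫ ω in (fun ω => Z ω + W ω) ⁻¹' s, h (Z ω) ∂P = 0 := by
    intro s hs
    rw [← setIntegral_condExp (m := MeasurableSpace.comap (fun ω => Z ω + W ω) inferInstance)
      hS.comap_le hint ⟨s, hs, rfl⟩]
    rw [integral_congr_ae (ae_restrict_of_ae hcond)]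
    simp
  have : IsProbabilityMeasure (P.map Z) := Measure.isProbabilityMeasure_map hZ.aemeasurable
  have : IsProbabilityMeasure (P.map W) := Measure.isProbabilityMeasure_map hW.aemeasurable
  have hint' : Integrable h (P.map Z) :=
    (integrable_map_measure hh.aestronglyMeasurable hZ.aemeasurable).2 hint
  have m1 : Measurable fun z => ENNReal.ofReal (h z) := hh.ennreal_ofReal
  have m2 : Measurable fun z => ENNReal.ofReal (-h z) := hh.neg.ennreal_ofReal
  have hfin1 : ∫⁻ z, ENNReal.ofReal (h z) ∂(P.map Z) ≠ ⊤ :=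
    (Integrable.lintegral_lt_top hint').ne
  have f1 : IsFiniteMeasure ((P.map Z).withDensity fun z => ENNReal.ofReal (h z)) :=
    isFiniteMeasure_withDensity hfin1
  have f2 : IsFiniteMeasure ((P.map Z).withDensity fun z => ENNReal.ofReal (-h z)) :=
    isFiniteMeasure_withDensity (Integrable.lintegral_lt_top hint'.neg).ne
  have hconv : Measure.conv ((P.map Z).withDensity fun z => ENNReal.ofReal (h z)) (P.map W)
      = Measure.conv ((P.map Z).withDensity fun z => ENNReal.ofReal (-h z)) (P.map W) := by
    ext s hs
    rw [conv_formula P Z W hZ hW hindep _ m1 s hs, conv_formula P Z W hZ hW hindep _ m2 s hs]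
    have h0 := hset s hs
    rw [integral_eq_lintegral_pos_part_sub_lintegral_neg_part hint.integrableOn, sub_eq_zero] at h0
    exact (ENNReal.toReal_eq_toReal_iff' (Integrable.lintegral_lt_top hint.integrableOn).ne
      (Integrable.lintegral_lt_top hint.neg.integrableOn).ne).1 h0
  have heq : ((P.map Z).withDensity fun z => ENNReal.ofReal (h z))
      = (P.map Z).withDensity fun z => ENNReal.ofReal (-h z) := by
    apply Measure.ext_of_charFun
    ext ξ
    have h2 := congrArg (fun μ => charFun μ ξ) hconv
    simp only [charFun_conv] at h2
    refine mul_right_cancel₀ ?_ h2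
    rw [hWlaw, ProbabilityTheory.charFun_gaussianReal]
    exact Complex.exp_ne_zero _
  have hae := (withDensity_eq_iff m1.aemeasurable m2.aemeasurable hfin1).1 heq
  filter_upwards [ae_of_ae_map hZ.aemeasurable hae] with ω hω
  simp only [Pi.zero_apply]
  rcases le_total (h (Z ω)) 0 with hle | hle
  · rw [ENNReal.ofReal_of_nonpos hle] at hω
    have := ENNReal.ofReal_eq_zero.1 hω.symm
    linarith
  · rw [ENNReal.ofReal_of_nonpos (neg_nonpos.2 hle)] at hω
    have := ENNReal.ofReal_eq_zero.1 hω
    linarith
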